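/- arXiv:2603.06076 — 3 statements merged into one kernel-verified Lean document; each statement's English description precedes it below -/
import Mathlib

section
/- Let r, s be positive integers, N = {1,…,r}, K = {1,…,s}, V = ℝ^K. Let I be a countable set and, for each i ∈ I, let γ^i : V^N → V^N be given by γ^i(x) = (α^i_n x_n + a^i_n)_{n∈N} with scalars α^i_n ∈ (0,1) and a^i_n ∈ V. Assume that ∑_{i∈I} β^i = 1, where β^i = ∏_{n∈N} α^i_n. Let λ = (λ_k)_{k ∈ K^N} be a family of reals and define f : V^N → ℝ by f(x) = ∑_{k ∈ K^N} λ_k ∏_{n∈N} x_{n,k_n}. Then □f(γ^i(0), γ^i(x)) = β^i f(x) for every i ∈ I and x ∈ V^N; consequently, for every x ∈ V^N the family (□f(γ^i(0), γ^i(x)))_{i∈I} is absolutely summable and ∑_{i∈I} □f(γ^i(0), γ^i(x)) = f(x). -/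
open MeasureTheory

/-- The multidimensional increment `□f(x,y) = ∑_{M ⊆ N} (−1)^{|M|} f(π_M(x,y))`,
where `π_M(x,y)(n) = x n` if `n ∈ M` and `y n` otherwise. -/
noncomputable def mwBoxIncr {N : Type*} [Fintype N] [DecidableEq N] {α : Type*}
    (f : (N → α) → ℝ) (x y : N → α) : ℝ :=
  ∑ M : Finset N, (-1 : ℝ) ^ M.card * f (fun n => if n ∈ M then x n else y n)

/-- The multidimensional increment for grouped coordinates `V^N = ℝ^{N×K}`:
subsets `M` range over the first factor only. -/
noncomputable def mwBoxIncrG {r s : ℕ} (f : (Fin r × Fin s → ℝ) → ℝ)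
    (x y : Fin r × Fin s → ℝ) : ℝ :=
  ∑ M : Finset (Fin r), (-1 : ℝ) ^ M.card * f (fun l => if l.1 ∈ M then x l else y l)

/-- Partial derivative of `f` in the coordinate `l`. -/
noncomputable def mwPD {ι : Type*} [DecidableEq ι] (l : ι) (f : (ι → ℝ) → ℝ) :
    (ι → ℝ) → ℝ :=
  fun x => deriv (fun t => f (Function.update x l t)) (x l)

/-- Iterated partial derivative along a list of coordinates (leftmost applied last). -/
noncomputable def mwIterPD {ι : Type*} [DecidableEq ι] (ls : List ι)
    (f : (ι → ℝ) → ℝ) : (ι → ℝ) → ℝ :=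
  ls.foldr mwPD f

/-- Existence (everywhere) of the iterated partial derivative along a list. -/
def mwExistsIterPD {ι : Type*} [DecidableEq ι] : List ι → ((ι → ℝ) → ℝ) → Prop
  | [], _ => True
  | l :: ls, f => mwExistsIterPD ls f ∧
      ∀ x, DifferentiableAt ℝ (fun t => mwIterPD ls f (Function.update x l t)) (x l)

/-- `f : ℝ^N → ℝ` is a `C^N`-function (case `s = 1`): for every `M ⊆ N`, `∂_M f`
exists everywhere and is continuous. -/
def mwIsCN {r : ℕ} (f : (Fin r → ℝ) → ℝ) : Prop :=
  ∀ M : Finset (Fin r),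
    mwExistsIterPD (M.sort (· ≤ ·)) f ∧ Continuous (mwIterPD (M.sort (· ≤ ·)) f)

/-- `∂_N f = ∂_1 ⋯ ∂_r f`. -/
noncomputable def mwDN {r : ℕ} (f : (Fin r → ℝ) → ℝ) : (Fin r → ℝ) → ℝ :=
  mwIterPD ((Finset.univ : Finset (Fin r)).sort (· ≤ ·)) f

/-- `f : V^N → ℝ` (with `V = ℝ^K`) is a `C^N`-function: for every `M ⊆ N` and
`k ∈ K^M`, the iterated partial derivative `∂̃_k f` exists everywhere and is continuous. -/
def mwIsCNG {r s : ℕ} (f : (Fin r × Fin s → ℝ) → ℝ) : Prop :=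
  ∀ (M : Finset (Fin r)) (k : Fin r → Fin s),
    mwExistsIterPD ((M.sort (· ≤ ·)).map (fun m => (m, k m))) f ∧
    Continuous (mwIterPD ((M.sort (· ≤ ·)).map (fun m => (m, k m))) f)

/-- `γ^{i_1} ∘ ⋯ ∘ γ^{i_p}` for a multi-index `i ∈ I^p`. -/
def mwComp {I β : Type*} (γ : I → β → β) {p : ℕ} (i : Fin p → I) : β → β :=
  (List.ofFn i).foldr (fun j g => γ j ∘ g) id

/-- `Q(a,b) = ∏_{n} [a_n, b_n)`. -/
def mwQ {r : ℕ} (a b : Fin r → ℝ) : Set (Fin r → ℝ) :=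
  {z | ∀ n, a n ≤ z n ∧ z n < b n}

/-- `Π(x,y) = ∏_n {x_n, y_n}`. -/
def mwPi {N α : Type*} (x y : N → α) : Set (N → α) :=
  {z | ∀ n, z n = x n ∨ z n = y n}

/-- `Π(x,y) = ∏_n {x_n, y_n}` for grouped coordinates, `x_n ∈ V = ℝ^K`. -/
def mwPiG {r s : ℕ} (x y : Fin r × Fin s → ℝ) : Set (Fin r × Fin s → ℝ) :=
  {z | ∀ n : Fin r, (∀ k, z (n, k) = x (n, k)) ∨ (∀ k, z (n, k) = y (n, k))}

/-- Euclidean norm on `ℝ^N`. -/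
noncomputable def mwNorm {r : ℕ} (x : Fin r → ℝ) : ℝ := Real.sqrt (∑ n, x n ^ 2)

/-- Euclidean diameter of a subset of `ℝ^N`. -/
noncomputable def mwDiam {r : ℕ} (T : Set (Fin r → ℝ)) : ℝ :=
  sSup {d | ∃ u ∈ T, ∃ v ∈ T, d = mwNorm (u - v)}

/-- `ω_T(g,δ) = sup {|g(u) − g(v)| : u ∈ T, ‖u − v‖ < δ}`. -/
noncomputable def mwOmega {r : ℕ} (T : Set (Fin r → ℝ)) (g : (Fin r → ℝ) → ℝ)
    (δ : ℝ) : ℝ :=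
  sSup {d | ∃ u ∈ T, ∃ v, mwNorm (u - v) < δ ∧ d = |g u - g v|}

/-- `𝕄^p f(x) = ∑_{i ∈ I^p} □f(γ^i(0), γ^i(x))`. -/
noncomputable def mwMWp {r : ℕ} {I : Type*} (γ : I → (Fin r → ℝ) → (Fin r → ℝ))
    (f : (Fin r → ℝ) → ℝ) (p : ℕ) (x : Fin r → ℝ) : ℝ :=
  ∑' i : Fin p → I, mwBoxIncr f (mwComp γ i 0) (mwComp γ i x)

/-- Iterates of the MW-operator: `𝕄^0 f = f`,
`𝕄^{k+1} f(x) = ∑_{i ∈ I} □(𝕄^k f)(γ^i(0), γ^i(x))`. -/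
noncomputable def mwMWiter {N α I : Type*} [Fintype N] [DecidableEq N] [Zero α]
    (γ : I → (N → α) → (N → α)) (f : (N → α) → ℝ) : ℕ → ((N → α) → ℝ)
  | 0 => f
  | k + 1 => fun x => ∑' i : I, mwBoxIncr (mwMWiter γ f k) (γ i 0) (γ i x)

/-- The alternating sum over subsets of the mixed products of `u` and `v` is `∏ (v n - u n)`. -/
theorem sum_neg_one_pow_card_mul_prod_ite {N : Type*} [Fintype N] [DecidableEq N]
    {R : Type*} [CommRing R] (u v : N → R) :
    ∑ M : Finset N, (-1 : R) ^ M.card * ∏ n, (if n ∈ M then u n else v n) =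
      ∏ n, (v n - u n) := by
  simp only [sub_eq_neg_add, Fintype.prod_add]
  refine Finset.sum_congr rfl fun M _ => ?_
  rw [Finset.prod_neg, mul_assoc, ← Finset.prod_mul_prod_compl M]
  congr 2
  · exact Finset.prod_congr rfl fun n hn => if_pos hn
  · exact Finset.prod_congr rfl fun n hn => if_neg (Finset.mem_compl.mp hn)

/-- The multidimensional increment of a multilinear form at `(x, y)` is its value at
`y - x`. -/
theorem mwBoxIncrG_sum_mul_prod {r s : ℕ} (lam : (Fin r → Fin s) → ℝ)
    (f : (Fin r × Fin s → ℝ) → ℝ)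
    (hf : ∀ x, f x = ∑ k : Fin r → Fin s, lam k * ∏ n, x (n, k n))
    (x y : Fin r × Fin s → ℝ) :
    mwBoxIncrG f x y = f (y - x) := by
  simp only [mwBoxIncrG, hf, Finset.mul_sum, Pi.sub_apply]
  rw [Finset.sum_comm]
  refine Finset.sum_congr rfl fun k _ => ?_
  rw [← sum_neg_one_pow_card_mul_prod_ite, Finset.mul_sum]
  exact Finset.sum_congr rfl fun M _ => mul_left_comm _ _ _

/-- for `f(x) = ∑_{k ∈ K^N} λ_k ∏_n x_{n,k_n}` and affine contractions
`γ^i` with `∑_i β^i = 1`, one has `□f(γ^i(0), γ^i(x)) = β^i f(x)`, the family is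
absolutely summable, and `∑_i □f(γ^i(0), γ^i(x)) = f(x)`. -/
theorem stmt12 {r s : ℕ} (hr : 0 < r) (hs : 0 < s) {I : Type*} [Countable I]
    (α : I → Fin r → ℝ) (a : I → Fin r × Fin s → ℝ)
    (hα : ∀ i n, 0 < α i n ∧ α i n < 1)
    (γ : I → (Fin r × Fin s → ℝ) → (Fin r × Fin s → ℝ))
    (hγ : ∀ i x l, γ i x l = α i l.1 * x l + a i l)
    (hsum : HasSum (fun i : I => ∏ n, α i n) 1)
    (lam : (Fin r → Fin s) → ℝ)
    (f : (Fin r × Fin s → ℝ) → ℝ)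
    (hf : ∀ x, f x = ∑ k : Fin r → Fin s, lam k * ∏ n, x (n, k n)) :
    (∀ i x, mwBoxIncrG f (γ i 0) (γ i x) = (∏ n, α i n) * f x) ∧
    ∀ x, Summable (fun i : I => |mwBoxIncrG f (γ i 0) (γ i x)|) ∧
      ∑' i : I, mwBoxIncrG f (γ i 0) (γ i x) = f x := by
  have hbox : ∀ i x, mwBoxIncrG f (γ i 0) (γ i x) = (∏ n, α i n) * f x := by
    intro i x
    rw [mwBoxIncrG_sum_mul_prod lam f hf, hf, hf, Finset.mul_sum]
    refine Finset.sum_congr rfl fun k _ => ?_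
    simp only [Pi.sub_apply, hγ, Pi.zero_apply, mul_zero, zero_add, add_sub_cancel_right,
      Finset.prod_mul_distrib]
    ring
  refine ⟨hbox, fun x => ?_⟩
  have hx : HasSum (fun i => mwBoxIncrG f (γ i 0) (γ i x)) (f x) := by
    simpa only [hbox, one_mul] using hsum.mul_right (f x)
  exact ⟨hx.summable.abs, hx.tsum_eq⟩
end

section
/- Let f : [0,1] → ℝ be the restriction of a continuously differentiable function on ℝ (equivalently, f is continuously differentiable on [0,1]). Then f satisfies the Matkowski–Wesołowski functional equation f(x) = f(x/2) − f(0) + f((x+1)/2) − f(1/2) for every x ∈ [0,1] if and only if there exists λ ∈ ℝ such that f(x) = λx for every x ∈ [0,1]. -/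
open MeasureTheory

open Set Filter Topology in
/-- A continuous fixed point of the dyadic averaging operator on `[0,1]` is maximal at `0`. -/
lemma le_apply_zero_of_dyadic_average {g : ℝ → ℝ} (hg : Continuous g)
    (h : ∀ x ∈ Icc (0 : ℝ) 1, g x = (g (x / 2) + g ((x + 1) / 2)) / 2) :
    ∀ x ∈ Icc (0 : ℝ) 1, g x ≤ g 0 := by
  obtain ⟨c, hc, hmax⟩ := isCompact_Icc.exists_isMaxOn (nonempty_Icc.2 (zero_le_one' ℝ))
    hg.continuousOn
  rw [isMaxOn_iff] at hmax
  have key : ∀ n : ℕ, c * (1 / 2) ^ n ∈ Icc (0 : ℝ) 1 ∧ g (c * (1 / 2) ^ n) = g c := by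
    intro n
    induction n with
    | zero => simpa using hc
    | succ n ih =>
      obtain ⟨hmem, heq⟩ := ih
      have hhalf : c * (1 / 2) ^ (n + 1) = c * (1 / 2) ^ n / 2 := by ring
      rw [hhalf]
      have h1 : c * (1 / 2) ^ n / 2 ∈ Icc (0 : ℝ) 1 :=
        ⟨by linarith [hmem.1], by linarith [hmem.1, hmem.2]⟩
      have h2 : (c * (1 / 2) ^ n + 1) / 2 ∈ Icc (0 : ℝ) 1 :=
        ⟨by linarith [hmem.1], by linarith [hmem.2]⟩
      exact ⟨h1, by linarith [h _ hmem, hmax _ h1, hmax _ h2]⟩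
  have hlim : Tendsto (fun n : ℕ => c * (1 / 2 : ℝ) ^ n) atTop (𝓝 0) := by
    simpa using (tendsto_pow_atTop_nhds_zero_of_lt_one (r := (1 / 2 : ℝ))
      (by norm_num) (by norm_num)).const_mul c
  have h0 : g c = g 0 := by
    refine tendsto_nhds_unique ?_ ((hg.tendsto 0).comp hlim)
    exact tendsto_const_nhds.congr fun n => (key n).2.symm
  exact fun x hx => h0 ▸ hmax x hx

open Set Filter Topology in
/-- The derivative of a solution of the Matkowski–Wesołowski equation is a fixed point of the
dyadic averaging operator. -/
lemma deriv_eq_dyadic_average {f : ℝ → ℝ} (hf : ContDiff ℝ 1 f)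
    (h : ∀ x ∈ Icc (0 : ℝ) 1, f x = f (x / 2) - f 0 + f ((x + 1) / 2) - f (1 / 2)) :
    ∀ x ∈ Icc (0 : ℝ) 1, deriv f x = (deriv f (x / 2) + deriv f ((x + 1) / 2)) / 2 := by
  have hd : ∀ y, HasDerivAt f (deriv f y) y := fun y =>
    (hf.differentiable one_ne_zero y).hasDerivAt
  have hc : Continuous (deriv f) := hf.continuous_deriv le_rfl
  have hopen : EqOn (deriv f) (fun x => (deriv f (x / 2) + deriv f ((x + 1) / 2)) / 2)
      (Ioo (0 : ℝ) 1) := by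
    intro x hx
    have h1 : HasDerivAt (fun y => f (y / 2)) (deriv f (x / 2) * (1 / 2)) x :=
      (hd (x / 2)).comp x ((hasDerivAt_id x).div_const 2)
    have h2 : HasDerivAt (fun y => f ((y + 1) / 2)) (deriv f ((x + 1) / 2) * (1 / 2)) x :=
      (hd ((x + 1) / 2)).comp x (((hasDerivAt_id x).add_const 1).div_const 2)
    have h3 := ((h1.sub_const (f 0)).add h2).sub_const (f (1 / 2))
    have h4 := h3.congr_of_eventuallyEq (f₁ := f) <| by
      filter_upwards [Ioo_mem_nhds hx.1 hx.2] with y hy using h y (Ioo_subset_Icc_self hy)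
    rw [h4.deriv]
    ring
  have hclosed := hopen.closure hc (by fun_prop)
  rw [closure_Ioo zero_ne_one] at hclosed
  exact hclosed

/-- a continuously differentiable function on `[0,1]` (given as the
restriction of a `C¹` function on `ℝ`) satisfies the Matkowski–Wesołowski equation
iff it is of the form `f(x) = λx`. -/
theorem stmt18 (f : ℝ → ℝ) (hf : ContDiff ℝ 1 f) :
    (∀ x ∈ Set.Icc (0 : ℝ) 1,
      f x = f (x / 2) - f 0 + f ((x + 1) / 2) - f (1 / 2)) ↔
    ∃ lam : ℝ, ∀ x ∈ Set.Icc (0 : ℝ) 1, f x = lam * x := by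
  constructor
  · intro h
    have havg := deriv_eq_dyadic_average hf h
    have hc : Continuous (deriv f) := hf.continuous_deriv le_rfl
    have hle := le_apply_zero_of_dyadic_average hc havg
    have hge := le_apply_zero_of_dyadic_average hc.neg fun x hx => by
      simp only [Pi.neg_apply]
      linarith [havg x hx]
    simp only [Pi.neg_apply, neg_le_neg_iff] at hge
    have hf0 : f 0 = 0 := by
      have h0 := h 0 (by simp)
      norm_num at h0
      linarith
    refine ⟨deriv f 0, fun x hx => ?_⟩
    have hd : ∀ y, HasDerivAt (fun t => f t - deriv f 0 * t) (deriv f y - deriv f 0) y := by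
      intro y
      have hlin : HasDerivAt (fun t => deriv f 0 * t) (deriv f 0) y := by
        simpa using (hasDerivAt_id y).const_mul (deriv f 0)
      exact (hf.differentiable one_ne_zero y).hasDerivAt.sub hlin
    have hconst := constant_of_has_deriv_right_zero
      (fun y _ => (hd y).continuousAt.continuousWithinAt)
      (fun y hy => by
        have hy' := Set.Ico_subset_Icc_self hy
        have hzero : deriv f y - deriv f 0 = 0 := by linarith [hle y hy', hge y hy']
        have hdy := hd y
        rw [hzero] at hdy
        exact hdy.hasDerivWithinAt) x hx
    simp only [hf0, mul_zero, sub_zero] at hconst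
    linarith
  · rintro ⟨lam, h⟩ x hx
    have hx0 := hx.1
    have hx1 := hx.2
    rw [h x hx, h 0 (by simp), h (x / 2) ⟨by linarith, by linarith⟩,
      h ((x + 1) / 2) ⟨by linarith, by linarith⟩, h (1 / 2) ⟨by norm_num, by norm_num⟩]
    ring
end

section
/- Let f : [0,1]² → ℝ be the restriction of a twice continuously differentiable function on ℝ². Then f satisfies f(x,y) = ∑_{i∈{0,1}} ∑_{j∈{0,1}} [ f((x+i)/2, (y+j)/2) − f(i/2, (y+j)/2) − f((x+i)/2, j/2) + f(i/2, j/2) ] for every (x,y) ∈ [0,1]² if and only if there exists λ ∈ ℝ such that f(x,y) = λxy for every (x,y) ∈ [0,1]². -/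
open MeasureTheory

/-- A continuous function on the plane that, on the open unit square, is invariant under
averaging over the four dyadic maps is constant there. -/
lemma eq_of_dyadic_average {g : ℝ × ℝ → ℝ} (hg : Continuous g)
    (havg : ∀ x ∈ Set.Ioo (0 : ℝ) 1, ∀ y ∈ Set.Ioo (0 : ℝ) 1,
      g (x, y) = ∑ i : Fin 2, ∑ j : Fin 2, g ((x + (i : ℝ)) / 2, (y + (j : ℝ)) / 2) / 4)
    {x y x' y' : ℝ} (hx : x ∈ Set.Ioo (0 : ℝ) 1) (hy : y ∈ Set.Ioo (0 : ℝ) 1)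
    (hx' : x' ∈ Set.Ioo (0 : ℝ) 1) (hy' : y' ∈ Set.Ioo (0 : ℝ) 1) :
    g (x, y) = g (x', y') := by
  refine eq_of_forall_dist_le fun ε hε => ?_
  have huc : UniformContinuousOn g (Set.Icc (0 : ℝ) 1 ×ˢ Set.Icc (0 : ℝ) 1) :=
    (isCompact_Icc.prod isCompact_Icc).uniformContinuousOn_of_continuous hg.continuousOn
  obtain ⟨δ, hδ, hgδ⟩ := Metric.uniformContinuousOn_iff.1 huc ε hε
  obtain ⟨n, hn⟩ := exists_pow_lt_of_lt_one hδ (by norm_num : (1 / 2 : ℝ) < 1)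
  have key : ∀ m : ℕ, ∀ x ∈ Set.Ioo (0 : ℝ) 1, ∀ y ∈ Set.Ioo (0 : ℝ) 1,
      ∀ x' ∈ Set.Ioo (0 : ℝ) 1, ∀ y' ∈ Set.Ioo (0 : ℝ) 1,
      |x - x'| < 2 ^ m * δ → |y - y'| < 2 ^ m * δ → |g (x, y) - g (x', y')| ≤ ε := by
    intro m
    induction m with
    | zero =>
      intro x hx y hy x' hx' y' hy' h1 h2
      refine (hgδ (x, y) ⟨Set.Ioo_subset_Icc_self hx, Set.Ioo_subset_Icc_self hy⟩ (x', y')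
        ⟨Set.Ioo_subset_Icc_self hx', Set.Ioo_subset_Icc_self hy'⟩ ?_).le
      rw [Prod.dist_eq]
      exact max_lt (by simpa [Real.dist_eq] using h1) (by simpa [Real.dist_eq] using h2)
    | succ m ih =>
      intro x hx y hy x' hx' y' hy' h1 h2
      have mem : ∀ {t : ℝ}, t ∈ Set.Ioo (0 : ℝ) 1 → ∀ i : Fin 2,
          (t + (i : ℝ)) / 2 ∈ Set.Ioo (0 : ℝ) 1 := by
        rintro t ⟨h0, h1⟩ i
        fin_cases i <;> constructor <;> norm_num <;> linarith
      have close : ∀ {s t : ℝ}, |s - t| < 2 ^ (m + 1) * δ → ∀ i : Fin 2,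
          |(s + (i : ℝ)) / 2 - (t + (i : ℝ)) / 2| < 2 ^ m * δ := by
        intro s t h i
        rw [show (s + (i : ℝ)) / 2 - (t + (i : ℝ)) / 2 = (s - t) / 2 by ring, abs_div, abs_two]
        rw [pow_succ] at h
        linarith
      have H : ∀ i j : Fin 2, |g ((x + (i : ℝ)) / 2, (y + (j : ℝ)) / 2)
          - g ((x' + (i : ℝ)) / 2, (y' + (j : ℝ)) / 2)| ≤ ε := fun i j =>
        ih _ (mem hx i) _ (mem hy j) _ (mem hx' i) _ (mem hy' j) (close h1 i) (close h2 j)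
      rw [havg x hx y hy, havg x' hx' y' hy']
      have h00 := abs_le.1 (H 0 0)
      have h01 := abs_le.1 (H 0 1)
      have h10 := abs_le.1 (H 1 0)
      have h11 := abs_le.1 (H 1 1)
      simp only [Fin.sum_univ_two]
      rw [abs_le]
      constructor <;> linarith [h00.1, h00.2, h01.1, h01.2, h10.1, h10.2, h11.1, h11.2]
  have hlt : (1 : ℝ) < 2 ^ n * δ := by
    have h2 : (0 : ℝ) < 2 ^ n := by positivity
    have := mul_lt_mul_of_pos_left hn h2
    rwa [← mul_pow, show (2 : ℝ) * (1 / 2) = 1 by norm_num, one_pow] at this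
  rw [Real.dist_eq]
  refine key n x hx y hy x' hx' y' hy' ?_ ?_ <;> refine lt_trans ?_ hlt <;> rw [abs_lt]
  · constructor <;> linarith [hx.1, hx.2, hx'.1, hx'.2]
  · constructor <;> linarith [hy.1, hy.2, hy'.1, hy'.2]

lemma Differentiable.hasDerivAt_slice_left {f : ℝ × ℝ → ℝ} (hf : Differentiable ℝ f)
    (x y : ℝ) : HasDerivAt (fun t => f (t, y)) (fderiv ℝ f (x, y) (1, 0)) x :=
  (hf (x, y)).hasFDerivAt.comp_hasDerivAt x ((hasDerivAt_id x).prodMk (hasDerivAt_const x y))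

lemma Differentiable.hasDerivAt_slice_right {f : ℝ × ℝ → ℝ} (hf : Differentiable ℝ f)
    (x y : ℝ) : HasDerivAt (fun t => f (x, t)) (fderiv ℝ f (x, y) (0, 1)) y :=
  (hf (x, y)).hasFDerivAt.comp_hasDerivAt y ((hasDerivAt_const y x).prodMk (hasDerivAt_id y))

/-- A function vanishing at `0` whose derivative is constant on `(0, 1)` is linear on `[0, 1]`. -/
lemma eq_mul_of_hasDerivAt_const {u u' : ℝ → ℝ} {c : ℝ} (h0 : u 0 = 0)
    (hu : ∀ t, HasDerivAt u (u' t) t) (hc : ∀ t ∈ Set.Ioo (0 : ℝ) 1, u' t = c)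
    {t : ℝ} (ht : t ∈ Set.Icc (0 : ℝ) 1) : u t = c * t := by
  rcases ht.1.eq_or_lt with rfl | hpos
  · simp [h0]
  · obtain ⟨s, hs, hs'⟩ := exists_hasDerivAt_eq_slope u u' hpos
      (fun r _ => (hu r).continuousAt.continuousWithinAt) (fun r _ => hu r)
    rw [hc s ⟨hs.1, hs.2.trans_le ht.2⟩, h0, sub_zero, sub_zero] at hs'
    rw [hs', div_mul_cancel₀ _ hpos.ne']

lemma HasDerivAt.comp_half_add {u u' : ℝ → ℝ} (hu : ∀ t, HasDerivAt u (u' t) t) (c t : ℝ) :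
    HasDerivAt (fun s => u ((s + c) / 2)) (u' ((t + c) / 2) / 2) t := by
  have h := (hu ((t + c) / 2)).comp t (((hasDerivAt_id t).add_const c).div_const 2)
  simpa [Function.comp_def, div_eq_mul_inv] using h

/-- a twice continuously differentiable function on `[0,1]²` (given as
the restriction of a `C²` function on `ℝ²`) satisfies the two-dimensional
Matkowski–Wesołowski equation iff it is of the form `f(x,y) = λxy`. -/
theorem stmt19 (f : ℝ × ℝ → ℝ) (hf : ContDiff ℝ 2 f) :
    (∀ x ∈ Set.Icc (0 : ℝ) 1, ∀ y ∈ Set.Icc (0 : ℝ) 1,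
      f (x, y) = ∑ i : Fin 2, ∑ j : Fin 2,
        (f ((x + (i : ℝ)) / 2, (y + (j : ℝ)) / 2)
          - f ((i : ℝ) / 2, (y + (j : ℝ)) / 2)
          - f ((x + (i : ℝ)) / 2, (j : ℝ) / 2)
          + f ((i : ℝ) / 2, (j : ℝ) / 2))) ↔
    ∃ lam : ℝ, ∀ x ∈ Set.Icc (0 : ℝ) 1, ∀ y ∈ Set.Icc (0 : ℝ) 1,
      f (x, y) = lam * (x * y) := by
  constructor
  · intro h
    let p : ℝ × ℝ → ℝ := fun z => fderiv ℝ f z (0, 1)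
    let g : ℝ × ℝ → ℝ := fun z => fderiv ℝ p z (1, 0)
    have hpC : ContDiff ℝ 1 p := (hf.fderiv_right (by norm_num)).clm_apply contDiff_const
    have hgC : Continuous g :=
      (hpC.continuous_fderiv one_ne_zero).clm_apply continuous_const
    have hfp : ∀ x y, HasDerivAt (fun t => f (x, t)) (p (x, y)) y :=
      (hf.differentiable two_ne_zero).hasDerivAt_slice_right
    have hpg : ∀ y x, HasDerivAt (fun t => p (t, y)) (g (x, y)) x := fun y x =>
      (hpC.differentiable one_ne_zero).hasDerivAt_slice_left x y
    have hp_eq : ∀ x ∈ Set.Icc (0 : ℝ) 1, ∀ y ∈ Set.Ioo (0 : ℝ) 1,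
        p (x, y) = ∑ i : Fin 2, ∑ j : Fin 2,
          (p ((x + (i : ℝ)) / 2, (y + (j : ℝ)) / 2) / 2
            - p ((i : ℝ) / 2, (y + (j : ℝ)) / 2) / 2) := by
      intro x hx y hy
      refine (hfp x y).unique (HasDerivAt.congr_of_eventuallyEq
        (f := fun t => ∑ i : Fin 2, ∑ j : Fin 2,
        (f ((x + (i : ℝ)) / 2, (t + (j : ℝ)) / 2)
          - f ((i : ℝ) / 2, (t + (j : ℝ)) / 2)
          - f ((x + (i : ℝ)) / 2, (j : ℝ) / 2)
          + f ((i : ℝ) / 2, (j : ℝ) / 2))) ?_ ?_)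
      · refine HasDerivAt.fun_sum fun i _ => HasDerivAt.fun_sum fun j _ => ?_
        exact (((HasDerivAt.comp_half_add (hfp _) _ y).sub
          (HasDerivAt.comp_half_add (hfp _) _ y)).sub_const _).add_const _
      · filter_upwards [Ioo_mem_nhds hy.1 hy.2] with t ht
        exact h x hx t (Set.Ioo_subset_Icc_self ht)
    have hg_eq : ∀ x ∈ Set.Ioo (0 : ℝ) 1, ∀ y ∈ Set.Ioo (0 : ℝ) 1,
        g (x, y) = ∑ i : Fin 2, ∑ j : Fin 2,
          g ((x + (i : ℝ)) / 2, (y + (j : ℝ)) / 2) / 4 := by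
      intro x hx y hy
      refine (hpg y x).unique (HasDerivAt.congr_of_eventuallyEq
        (f := fun t => ∑ i : Fin 2, ∑ j : Fin 2,
          (p ((t + (i : ℝ)) / 2, (y + (j : ℝ)) / 2) / 2
            - p ((i : ℝ) / 2, (y + (j : ℝ)) / 2) / 2)) ?_ ?_)
      · refine HasDerivAt.fun_sum fun i _ => HasDerivAt.fun_sum fun j _ => ?_
        convert ((HasDerivAt.comp_half_add (hpg ((y + (j : ℝ)) / 2)) (i : ℝ) x).div_const
          2).sub_const (p ((i : ℝ) / 2, (y + (j : ℝ)) / 2) / 2) using 1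
        ring
      · filter_upwards [Ioo_mem_nhds hx.1 hx.2] with t ht
        exact hp_eq t (Set.Ioo_subset_Icc_self ht) y hy
    have half : (1 / 2 : ℝ) ∈ Set.Ioo (0 : ℝ) 1 := by norm_num
    have zero_mem : (0 : ℝ) ∈ Set.Icc (0 : ℝ) 1 := by norm_num
    refine ⟨g (1 / 2, 1 / 2), fun x hx y hy => ?_⟩
    have hp_lin : ∀ t ∈ Set.Ioo (0 : ℝ) 1, p (x, t) = g (1 / 2, 1 / 2) * x := by
      intro t ht
      refine eq_mul_of_hasDerivAt_const (u := fun s => p (s, t)) ?_ (hpg t)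
        (fun s hs => eq_of_dyadic_average hgC hg_eq hs ht half half) hx
      simpa using hp_eq 0 zero_mem t ht
    rw [← mul_assoc]
    refine eq_mul_of_hasDerivAt_const (u := fun t => f (x, t)) ?_ (hfp x) hp_lin hy
    simpa using h x hx 0 zero_mem
  · rintro ⟨lam, h⟩ x hx y hy
    have mem : ∀ {t : ℝ}, t ∈ Set.Icc (0 : ℝ) 1 → ∀ i : Fin 2,
        (t + (i : ℝ)) / 2 ∈ Set.Icc (0 : ℝ) 1 := by
      rintro t ⟨h0, h1⟩ i
      fin_cases i <;> constructor <;> norm_num <;> linarith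
    have mem₀ : ∀ i : Fin 2, (i : ℝ) / 2 ∈ Set.Icc (0 : ℝ) 1 := fun i => by
      simpa using mem (t := 0) (by norm_num) i
    have term : ∀ i j : Fin 2, f ((x + (i : ℝ)) / 2, (y + (j : ℝ)) / 2)
          - f ((i : ℝ) / 2, (y + (j : ℝ)) / 2)
          - f ((x + (i : ℝ)) / 2, (j : ℝ) / 2)
          + f ((i : ℝ) / 2, (j : ℝ) / 2) = lam * (x * y) / 4 := by
      intro i j
      rw [h _ (mem hx i) _ (mem hy j), h _ (mem₀ i) _ (mem hy j), h _ (mem hx i) _ (mem₀ j),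
        h _ (mem₀ i) _ (mem₀ j)]
      ring
    simp only [term, h x hx y hy, Fin.sum_univ_two]
    ring
end
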